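/- arXiv:2408.13187 — 4 statements merged into one kernel-verified Lean document; each statement's English description precedes it below -/
import Mathlib

section
/- Let ι be a finite index set, κ > 0 a real number, and λ, w, ε, ν, r : ι → ℝ functions such that: ν(v) ≥ 0 for all v; for each v, either ν(v) = 0 or r(v) ≤ ε(v); and ∑_{v∈ι} (κ·λ(v) − r(v))·ν(v) = 1. Suppose σ ≥ 0 is a real number such that λ(v) − 2·w(v) ≤ σ·(λ(v) − ε(v)/κ) for every v ∈ ι. Then 1 + ∑_{v∈ι} (r(v) − 2·κ·w(v))·ν(v) ≤ σ. -/
/-- Algebraic core of the main action–index estimate: if `ν ≥ 0`, each `v` has `ν v = 0` or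
`r v ≤ ε v`, `∑ (κ·λ v − r v)·ν v = 1`, `σ ≥ 0` and `λ v − 2·w v ≤ σ·(λ v − ε v / κ)` for
every `v`, then `1 + ∑ (r v − 2·κ·w v)·ν v ≤ σ`. -/
theorem main_action_index_estimate {ι : Type*} [Fintype ι]
    (κ : ℝ) (hκ : 0 < κ) (lam w ε ν r : ι → ℝ)
    (hν : ∀ v, 0 ≤ ν v)
    (hνr : ∀ v, ν v = 0 ∨ r v ≤ ε v)
    (hsum : ∑ v, (κ * lam v - r v) * ν v = 1)
    (σ : ℝ) (hσ : 0 ≤ σ)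
    (hle : ∀ v, lam v - 2 * w v ≤ σ * (lam v - ε v / κ)) :
    1 + ∑ v, (r v - 2 * κ * w v) * ν v ≤ σ := by
  have key : ∀ v, (κ * lam v - r v) * ν v + (r v - 2 * κ * w v) * ν v
      ≤ σ * ((κ * lam v - r v) * ν v) := by
    intro v
    rcases hνr v with h | h
    · simp [h]
    · have h1 := mul_le_mul_of_nonneg_left (hle v) hκ.le
      have h2 : κ * (σ * (lam v - ε v / κ)) = σ * (κ * lam v - ε v) := by
        field_simp
      have h3 : σ * (κ * lam v - ε v) ≤ σ * (κ * lam v - r v) :=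
        mul_le_mul_of_nonneg_left (by linarith) hσ
      have h4 : κ * (lam v - 2 * w v) ≤ σ * (κ * lam v - r v) := by linarith
      have h5 := mul_le_mul_of_nonneg_right h4 (hν v)
      linarith
  have h := Finset.sum_le_sum (s := Finset.univ) (fun v _ => key v)
  rw [Finset.sum_add_distrib, ← Finset.mul_sum, hsum, mul_one] at h
  exact h
end

section
/- Let M be a normal topological space and let A, B, W, I be subsets of M such that: the closure of A and the closure of B \ W are disjoint; and I is a neighbourhood of W ∩ B (that is, W ∩ B is contained in the interior of I). Then there exist subsets U_A, U_B ⊆ M such that U_A is a neighbourhood of A (A is contained in the interior of U_A), U_B is a neighbourhood of B, and U_A ∩ U_B = I. -/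
/-- Shrinking stratum neighbourhoods: in a normal space, if `closure A` and
`closure (B \ W)` are disjoint and `I` is a neighbourhood of `W ∩ B`, then there are
neighbourhoods `U_A` of `A` and `U_B` of `B` with `U_A ∩ U_B = I`. -/
theorem shrink_stratum_neighbourhoods {M : Type*} [TopologicalSpace M] [NormalSpace M]
    (A B W I : Set M)
    (hdisj : closure A ∩ closure (B \ W) = ∅)
    (hI : W ∩ B ⊆ interior I) :
    ∃ UA UB : Set M, A ⊆ interior UA ∧ B ⊆ interior UB ∧ UA ∩ UB = I := by
  obtain ⟨P, Q, hP, hQ, hAP, hBQ, hPQ⟩ := normal_separation (isClosed_closure (s := A))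
    (isClosed_closure (s := B \ W)) (Set.disjoint_iff_inter_eq_empty.mpr hdisj)
  refine ⟨P ∪ I, Q ∪ I, ?_, ?_, ?_⟩
  · exact (subset_closure.trans hAP).trans (interior_maximal Set.subset_union_left hP)
  · intro x hx
    by_cases hw : x ∈ W
    · exact interior_mono Set.subset_union_right (hI ⟨hw, hx⟩)
    · exact interior_maximal Set.subset_union_left hQ (hBQ (subset_closure ⟨hx, hw⟩))
  · rw [← Set.inter_union_distrib_right, hPQ.inter_eq, Set.empty_union]
end

section
/- Let M be a compact Hausdorff topological space, V a finite partially ordered set, and for each v ∈ V let D_v ⊆ M be subsets that are pairwise disjoint and satisfy: the closure of D_v equals ⋃_{u ≤ v} D_u. For each v ∈ V let U_v ⊆ M be an open set with D_v ⊆ U_v, and let r_v : M → ℝ be a continuous nonnegative function whose zero set {x | r_v(x) = 0} equals ⋃_{u ≤ v} D_u. Fix t > 0. Then there exist continuous, strictly increasing functions ε_v : [0,1] → ℝ with ε_v(0) = 0 for each v ∈ V, such that ε_v(R) ≤ t·ε_u(R) whenever u < v, and for every R ∈ (0,1] and every v ∈ V, the set {x ∈ M | r_v(x) ≤ ε_v(R)}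 ∩ {x ∈ M | r_u(x) ≥ (1/3)·ε_u(R) for all u < v} is contained in U_v. -/
open Filter Topology in
theorem cb_aux (P : ℝ → ℝ → Prop)
    (hc : ∀ c c' R, c ≤ c' → P c' R → P c R)
    (hR : ∀ c R R', 0 < R → R ≤ R' → R' ≤ 1 → P c R → P c R')
    (hex : ∀ R, 0 < R → R ≤ 1 → ∃ c, 0 < c ∧ P c R) :
    ∃ f : ℝ → ℝ, ContinuousOn f (Set.Icc 0 1) ∧ StrictMonoOn f (Set.Icc 0 1) ∧ f 0 = 0 ∧
      ∀ R ∈ Set.Ioc (0:ℝ) 1, P (f R) R := by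
  classical
  let S : ℝ → Set ℝ := fun R => {c | 0 ≤ c ∧ c ≤ 1 ∧ (c = 0 ∨ (0 < R ∧ P c R))}
  have h0S : ∀ R, (0:ℝ) ∈ S R := fun R => ⟨le_rfl, zero_le_one, Or.inl rfl⟩
  have hbdd : ∀ R, BddAbove (S R) := fun R => ⟨1, fun c h => h.2.1⟩
  let m : ℝ → ℝ := fun R => sSup (S R)
  have hm0 : ∀ R, 0 ≤ m R := fun R => le_csSup (hbdd R) (h0S R)
  have hmpos : ∀ R, 0 < R → R ≤ 1 → 0 < m R := by
    intro R h0 h1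
    obtain ⟨c, hc0, hP⟩ := hex R h0 h1
    have : min c 1 ∈ S R :=
      ⟨by positivity, min_le_right _ _, Or.inr ⟨h0, hc _ _ _ (min_le_left _ _) hP⟩⟩
    exact lt_of_lt_of_le (by positivity) (le_csSup (hbdd R) this)
  have hmono : MonotoneOn m (Set.Icc 0 1) := by
    intro a ha b hb hab
    refine csSup_le_csSup (hbdd b) ⟨0, h0S a⟩ ?_
    rintro c ⟨h1, h2, h3⟩
    refine ⟨h1, h2, h3.imp id ?_⟩
    rintro ⟨h4, h5⟩
    exact ⟨h4.trans_le hab, hR _ _ _ h4 hab hb.2 h5⟩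
  have hPm : ∀ R, 0 < R → R ≤ 1 → ∀ c, c < m R → P c R := by
    intro R h0 h1 c hcm
    obtain ⟨d, hd, hcd⟩ := exists_lt_of_lt_csSup ⟨0, h0S R⟩ hcm
    rcases hd.2.2 with h | h
    · obtain ⟨e, he, hP⟩ := hex R h0 h1
      exact hc _ _ _ (by linarith) hP
    · exact hc _ _ _ hcd.le h.2
  have hint : ∀ a ∈ Set.Icc (0:ℝ) 1, ∀ b ∈ Set.Icc (0:ℝ) 1,
      IntervalIntegrable m MeasureTheory.volume a b := by
    intro a ha b hb
    refine MonotoneOn.intervalIntegrable (hmono.mono ?_)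
    exact Set.uIcc_subset_Icc ha hb
  have z : (0:ℝ) ∈ Set.Icc (0:ℝ) 1 := by simp
  have o : (1:ℝ) ∈ Set.Icc (0:ℝ) 1 := by simp
  refine ⟨fun R => (1/2) * ∫ x in (0:ℝ)..R, m x, ?_, ?_, by simp, ?_⟩
  · refine ContinuousOn.mul continuousOn_const ?_
    have := intervalIntegral.continuousOn_primitive_interval (μ := MeasureTheory.volume)
      (f := m) (a := 0) (b := 1) ?_
    · rwa [Set.uIcc_of_le zero_le_one] at this
    · have := hint 0 z 1 o
      rwa [intervalIntegrable_iff', ] at this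
  · intro a ha b hb hab
    have h1 := intervalIntegral.integral_add_adjacent_intervals (hint 0 z a ha) (hint a ha b hb)
    have h2 : 0 < ∫ x in a..b, m x := by
      refine intervalIntegral.intervalIntegral_pos_of_pos_on (hint a ha b hb) ?_ hab
      intro x hx
      exact hmpos x (ha.1.trans_lt hx.1) (hx.2.le.trans hb.2)
    simp only
    linarith
  · intro R hRR
    have hRI : R ∈ Set.Icc (0:ℝ) 1 := ⟨hRR.1.le, hRR.2⟩
    refine hPm R hRR.1 hRR.2 _ ?_
    have h1 : ∫ x in (0:ℝ)..R, m x ≤ ∫ x in (0:ℝ)..R, m R := by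
      refine intervalIntegral.integral_mono_on hRR.1.le (hint 0 z R hRI) (by simp) ?_
      intro x hx
      exact hmono ⟨hx.1, hx.2.trans hRR.2⟩ hRI hx.2
    have h2 := hmpos R hRR.1 hRR.2
    simp only [intervalIntegral.integral_const, sub_zero, smul_eq_mul] at h1
    have := hRR.2
    nlinarith

theorem cb_rec {V F : Type*} [Nonempty F] [Fintype V] [PartialOrder V]
    (C : (v : V) → (∀ u, u < v → F) → F → Prop)
    (A' : F → Prop)
    (h : ∀ v (p : ∀ u, u < v → F), (∀ u hu, A' (p u hu)) → ∃ f, A' f ∧ C v p f) :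
    ∃ ε : V → F, ∀ v, A' (ε v) ∧ C v (fun u _ => ε u) (ε v) := by
  classical
  have wf : WellFounded (fun a b : V => a < b) := wellFounded_lt
  let ε : V → F := wf.fix (fun v p => Classical.epsilon (fun f => A' f ∧ C v p f))
  have he : ∀ v, ε v = Classical.epsilon (fun f => A' f ∧ C v (fun u _ => ε u) f) := by
    intro v
    exact wf.fix_eq _ v
  refine ⟨ε, fun v => ?_⟩
  induction v using wf.induction with
  | _ v ih =>
    rw [he v]
    exact Classical.epsilon_spec (h v (fun u _ => ε u) (fun u hu => (ih u hu).1))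

/-- Sufficiently small compact boxes: for a finite stratification `D v` of subsets of a
compact Hausdorff space with stratum neighbourhoods `U v` and continuous nonnegative
functions `r v` vanishing exactly on the closed strata, there exist continuous strictly
increasing smallness functions `ε v` with `ε v 0 = 0`, `ε v ≤ t · ε u` for `u < v`, such
that for each `R ∈ (0,1]` the box `{r v ≤ ε v R} ∩ {r u ≥ ε u R / 3 for all u < v}` is
contained in `U v`. -/
theorem compact_boxes {M V : Type*} [TopologicalSpace M] [CompactSpace M] [T2Space M]
    [Fintype V] [PartialOrder V]
    (D : V → Set M)
    (hdisj : Pairwise fun u v => Disjoint (D u) (D v))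
    (hclos : ∀ v, closure (D v) = ⋃ u ≤ v, D u)
    (U : V → Set M) (hUopen : ∀ v, IsOpen (U v)) (hDU : ∀ v, D v ⊆ U v)
    (r : V → M → ℝ) (hrcont : ∀ v, Continuous (r v)) (hrnn : ∀ v x, 0 ≤ r v x)
    (hrzero : ∀ v, {x | r v x = 0} = ⋃ u ≤ v, D u)
    (t : ℝ) (ht : 0 < t) :
    ∃ ε : V → ℝ → ℝ,
      (∀ v, ContinuousOn (ε v) (Set.Icc 0 1) ∧ StrictMonoOn (ε v) (Set.Icc 0 1) ∧
        ε v 0 = 0) ∧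
      (∀ u v : V, u < v → ∀ R ∈ Set.Icc (0:ℝ) 1, ε v R ≤ t * ε u R) ∧
      (∀ R ∈ Set.Ioc (0:ℝ) 1, ∀ v : V,
        ({x | r v x ≤ ε v R} ∩ {x | ∀ u, u < v → (1/3) * ε u R ≤ r u x}) ⊆ U v) := by
  refine Exists.elim (cb_rec (V := V) (F := ℝ → ℝ)
    (fun v p f => ∀ R ∈ Set.Ioc (0:ℝ) 1, (∀ u hu, f R ≤ t * p u hu R) ∧
      ∀ x, r v x ≤ f R → (∀ u hu, (1/3) * p u hu R ≤ r u x) → x ∈ U v)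
    (fun f => ContinuousOn f (Set.Icc 0 1) ∧ StrictMonoOn f (Set.Icc 0 1) ∧ f 0 = 0) ?_) (fun ε hε => ?_)
  rotate_left
  · refine ⟨ε, fun v => (hε v).1, ?_, ?_⟩
    · intro u v huv R hR
      rcases hR.1.eq_or_lt with h | h
      · rw [← h, (hε v).1.2.2, (hε u).1.2.2, mul_zero]
      · exact ((hε v).2 R ⟨h, hR.2⟩).1 u huv
    · rintro R hR v x ⟨h1, h2⟩
      exact ((hε v).2 R hR).2 x h1 h2
  · intro v p hp
    have hmon : ∀ u hu R R', 0 < R → R ≤ R' → R' ≤ 1 → p u hu R ≤ p u hu R' := by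
      intro u hu R R' h0 h1 h2
      exact (hp u hu).2.1.monotoneOn ⟨h0.le, h1.trans h2⟩ ⟨h0.le.trans h1, h2⟩ h1
    refine Exists.elim (cb_aux
      (fun c R => (∀ u hu, c ≤ t * p u hu R) ∧
        ∀ x, r v x ≤ c → (∀ u hu, (1/3) * p u hu R ≤ r u x) → x ∈ U v) ?_ ?_ ?_)
      (fun f hf => ⟨f, ⟨hf.1, hf.2.1, hf.2.2.1⟩, hf.2.2.2⟩)
    · rintro c c' R h ⟨h1, h2⟩
      exact ⟨fun u hu => h.trans (h1 u hu), fun x hx => h2 x (hx.trans h)⟩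
    · rintro c R R' h0 h h' ⟨h1, h2⟩
      refine ⟨fun u hu => (h1 u hu).trans
        (mul_le_mul_of_nonneg_left (hmon u hu R R' h0 h h') ht.le), fun x hx hx' => h2 x hx ?_⟩
      intro u hu
      have := hx' u hu
      have := hmon u hu R R' h0 h h'
      linarith
    · intro R h0 h1
      have hpos : ∀ u hu, 0 < p u hu R := by
        intro u hu
        have := (hp u hu).2.1 (⟨le_rfl, zero_le_one⟩ : (0:ℝ) ∈ Set.Icc (0:ℝ) 1) ⟨h0.le, h1⟩ h0
        rwa [(hp u hu).2.2] at this
      have e1 : ∀ᶠ c in nhdsWithin (0:ℝ) (Set.Ioi 0), ∀ u hu, c ≤ t * p u hu R := by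
        rw [Filter.eventually_all]
        intro u
        by_cases hu : u < v
        · have : ∀ᶠ c in nhds (0:ℝ), c < t * p u hu R :=
            eventually_lt_nhds (mul_pos ht (hpos u hu))
          filter_upwards [this.filter_mono nhdsWithin_le_nhds] with c hc _
          exact hc.le
        · exact Filter.Eventually.of_forall fun c hu' => absurd hu' hu
      have e2 : ∃ d > 0, ∀ x, r v x < d → (∀ u hu, (1/3) * p u hu R ≤ r u x) → x ∈ U v := by
        let K : Set M := (U v)ᶜ ∩ {x | ∀ u hu, (1/3) * p u hu R ≤ r u x}
        have hK : IsCompact K := by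
          refine IsClosed.isCompact ((hUopen v).isClosed_compl.inter ?_)
          simp only [Set.setOf_forall]
          exact isClosed_iInter fun u => isClosed_iInter fun hu =>
            isClosed_le continuous_const (hrcont u)
        rcases K.eq_empty_or_nonempty with hE | hN
        · refine ⟨1, one_pos, fun x _ hx => ?_⟩
          by_contra hxU
          have : x ∈ K := ⟨hxU, hx⟩
          simp [hE] at this
        · obtain ⟨y, hy, hmin⟩ := hK.exists_isMinOn hN (hrcont v).continuousOn
          refine ⟨r v y, ?_, fun x hx hx' => ?_⟩
          · refine lt_of_le_of_ne (hrnn v y) fun h => ?_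
            have h3 : y ∈ {x | r v x = 0} := h.symm
            rw [hrzero] at h3
            simp only [Set.mem_iUnion] at h3
            obtain ⟨u, huv, hyu⟩ := h3
            rcases huv.eq_or_lt with rfl | hlt
            · exact hy.1 (hDU _ hyu)
            · have h4 : y ∈ {x | r u x = 0} := by
                rw [hrzero]
                exact Set.mem_iUnion₂.2 ⟨u, le_rfl, hyu⟩
              have h5 := hy.2 u hlt
              have h6 : r u y = 0 := h4
              have := hpos u hlt
              linarith
          · by_contra hxU
            have h7 : r v y ≤ r v x := hmin (⟨hxU, hx'⟩ : x ∈ K)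
            linarith
      obtain ⟨d, hd, hd'⟩ := e2
      have e3 : ∀ᶠ c in nhdsWithin (0:ℝ) (Set.Ioi 0), c < d :=
        (eventually_lt_nhds hd).filter_mono nhdsWithin_le_nhds
      obtain ⟨c, ⟨ha, hb⟩, hc⟩ := ((e1.and e3).and self_mem_nhdsWithin).exists
      exact ⟨c, hc, ha, fun x hx => hd' x (hx.trans_lt hb)⟩
end

section
/- Let ι be a finite index set. Let g : ℝ → ℝ be continuous with g(x) = 0 for x ≤ 0, g strictly increasing on [0,∞), and g(1) = 1. For each v ∈ ι let ε_v : (0,1] → ℝ be continuous, strictly increasing and positive, with ε_v(R) → 0 as R → 0⁺. For R ∈ (0,1] and x ∈ ℝ^ι with all coordinates positive, set F(R, x) = R − 1 + ∑_{v∈ι} g(9 − 9·x_v/ε_v(R)). Then there exists a function f from the positive orthant {x ∈ ℝ^ι | x_v > 0 for all v} to (0,1] such that: (i) F(f(x), x) = 0 for every x in the positive orthant; (ii) f(x) is the unique R ∈ (0,1] with F(R,x) = 0; (iii) f is continuous on the positive orthant; and (iv) f is monotone: if x_v ≤ y_v for all v then f(x) ≤ f(y). -/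
/-- Implicit-function construction of the exhaustion function: with
`F(R,x) = R − 1 + ∑ v, g(9 − 9·x v / ε v R)`, there is a function `f` on the positive
orthant with values in `(0,1]` such that `F (f x) x = 0`, `f x` is the unique root of
`F (·) x` in `(0,1]`, `f` is continuous, and `f` is monotone. -/
theorem exhaustion_implicit_function {ι : Type*} [Fintype ι]
    (g : ℝ → ℝ) (hgc : Continuous g) (hg0 : ∀ x ≤ (0:ℝ), g x = 0)
    (hgmono : StrictMonoOn g (Set.Ici 0)) (hg1 : g 1 = 1)
    (ε : ι → ℝ → ℝ)
    (hεc : ∀ v, ContinuousOn (ε v) (Set.Ioc 0 1))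
    (hεmono : ∀ v, StrictMonoOn (ε v) (Set.Ioc 0 1))
    (hεpos : ∀ v, ∀ R ∈ Set.Ioc (0:ℝ) 1, 0 < ε v R)
    (hεlim : ∀ v, Filter.Tendsto (ε v) (nhdsWithin 0 (Set.Ioi 0)) (nhds 0))
    (F : ℝ → (ι → ℝ) → ℝ)
    (hF : ∀ R ∈ Set.Ioc (0:ℝ) 1, ∀ x : ι → ℝ,
      F R x = R - 1 + ∑ v, g (9 - 9 * x v / ε v R)) :
    ∃ f : (ι → ℝ) → ℝ,
      (∀ x : ι → ℝ, (∀ v, 0 < x v) → f x ∈ Set.Ioc (0:ℝ) 1 ∧ F (f x) x = 0) ∧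
      (∀ x : ι → ℝ, (∀ v, 0 < x v) → ∀ R ∈ Set.Ioc (0:ℝ) 1, F R x = 0 → R = f x) ∧
      ContinuousOn f {x : ι → ℝ | ∀ v, 0 < x v} ∧
      (∀ x y : ι → ℝ, (∀ v, 0 < x v) → (∀ v, 0 < y v) → (∀ v, x v ≤ y v) → f x ≤ f y) := by
  have hgm : Monotone g := by
    intro a b hab
    have hnn : ∀ c, 0 ≤ g c := by
      intro c
      rcases le_total c 0 with hc | hc
      · rw [hg0 c hc]
      · rw [← hg0 0 le_rfl]
        exact hgmono.monotoneOn (Set.mem_Ici.2 le_rfl) (Set.mem_Ici.2 hc) hc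
    rcases le_total a 0 with ha | ha
    · rw [hg0 a ha]
      exact hnn b
    · exact hgmono.monotoneOn (Set.mem_Ici.2 ha) (Set.mem_Ici.2 (ha.trans hab)) hab
  have hgnn : ∀ c, 0 ≤ g c := by
    intro c
    rcases le_total c 0 with hc | hc
    · rw [hg0 c hc]
    · rw [← hg0 0 le_rfl]
      exact hgm hc
  have hFR : ∀ x : ι → ℝ, (∀ v, 0 < x v) → StrictMonoOn (fun R => F R x) (Set.Ioc 0 1) := by
    intro x hx a ha b hb hab
    simp only [hF a ha, hF b hb]
    have : ∑ v, g (9 - 9 * x v / ε v a) ≤ ∑ v, g (9 - 9 * x v / ε v b) := by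
      refine Finset.sum_le_sum fun v _ => hgm ?_
      have h1 := hεpos v a ha
      have h2 := (hεmono v ha hb hab).le
      have h3 := hx v
      gcongr
    linarith
  have hFx : ∀ R ∈ Set.Ioc (0:ℝ) 1, ∀ x y : ι → ℝ, (∀ v, x v ≤ y v) → F R y ≤ F R x := by
    intro R hR x y hxy
    rw [hF R hR, hF R hR]
    have : ∑ v, g (9 - 9 * y v / ε v R) ≤ ∑ v, g (9 - 9 * x v / ε v R) := by
      refine Finset.sum_le_sum fun v _ => hgm ?_
      have h1 := hεpos v R hR
      have h3 := hxy v
      gcongr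
    linarith
  have hFc : ∀ R ∈ Set.Ioc (0:ℝ) 1, Continuous (fun x => F R x) := by
    intro R hR
    have : (fun x => F R x) = fun x : ι → ℝ => R - 1 + ∑ v, g (9 - 9 * x v / ε v R) :=
      funext fun x => hF R hR x
    rw [this]
    fun_prop
  have hex : ∀ x : ι → ℝ, (∀ v, 0 < x v) → ∃ R ∈ Set.Ioc (0:ℝ) 1, F R x = 0 := by
    intro x hx
    have hev : ∀ᶠ r in nhdsWithin (0:ℝ) (Set.Ioi 0), ∀ v, ε v r < x v :=
      Filter.eventually_all.2 fun v => (hεlim v).eventually (gt_mem_nhds (hx v))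
    have hev2 : ∀ᶠ r in nhdsWithin (0:ℝ) (Set.Ioi 0), r ∈ Set.Ioo (0:ℝ) 1 :=
      Ioo_mem_nhdsGT one_pos
    obtain ⟨r, hr, hr0, hr1⟩ := (hev.and hev2).exists
    have hrm : r ∈ Set.Ioc (0:ℝ) 1 := ⟨hr0, hr1.le⟩
    have hsub : Set.Icc r 1 ⊆ Set.Ioc (0:ℝ) 1 := fun t ht => ⟨hr0.trans_le ht.1, ht.2⟩
    have hc : ContinuousOn (fun R => F R x) (Set.Icc r 1) := by
      have : ContinuousOn (fun R => R - 1 + ∑ v, g (9 - 9 * x v / ε v R)) (Set.Icc r 1) := by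
        refine (by fun_prop : ContinuousOn (fun R : ℝ => R - 1) _).add ?_
        refine continuousOn_finsetSum _ fun v _ => hgc.comp_continuousOn ?_
        refine continuousOn_const.sub (continuousOn_const.div ((hεc v).mono hsub) ?_)
        intro t ht
        exact (hεpos v t (hsub ht)).ne'
      exact this.congr fun t ht => hF t (hsub ht) x
    have h0 : F r x ≤ 0 := by
      rw [hF r hrm, Finset.sum_eq_zero]
      · linarith
      · intro v _
        apply hg0
        have := (one_le_div (hεpos v r hrm)).2 (hr v).le
        rw [mul_div_assoc]
        linarith
    have h1 : 0 ≤ F 1 x := by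
      rw [hF 1 ⟨one_pos, le_rfl⟩]
      have : 0 ≤ ∑ v, g (9 - 9 * x v / ε v 1) := Finset.sum_nonneg fun v _ => hgnn _
      linarith
    obtain ⟨R, hR, hR0⟩ := intermediate_value_Icc hr1.le hc ⟨h0, h1⟩
    exact ⟨R, hsub hR, hR0⟩
  choose! f hfm hf0 using hex
  refine ⟨f, fun x hx => ⟨hfm x hx, hf0 x hx⟩, ?_, ?_, ?_⟩
  · intro x hx R hR h
    exact (hFR x hx).injOn hR (hfm x hx) (h.trans (hf0 x hx).symm)
  · intro x hx
    have hx' : ∀ v, 0 < x v := hx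
    refine tendsto_order.2 ⟨fun a ha => ?_, fun b hb => ?_⟩
    · rcases le_or_gt a 0 with h | h
      · filter_upwards [self_mem_nhdsWithin] with y hy
        exact h.trans_lt (hfm y hy).1
      · have ham : a ∈ Set.Ioc (0:ℝ) 1 := ⟨h, ha.le.trans (hfm x hx').2⟩
        have h1 : F a x < 0 := by
          have := hFR x hx' ham (hfm x hx') ha
          simpa only [hf0 x hx'] using this
        have h2 := ((hFc a ham).continuousWithinAt (s := {x : ι → ℝ | ∀ v, 0 < x v})
          (x := x)).eventually (gt_mem_nhds h1)
        filter_upwards [self_mem_nhdsWithin, h2] with y hy h2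
        have := ((hFR y hy).lt_iff_lt ham (hfm y hy)).1
        simp only [hf0 y hy] at this
        exact this h2
    · rcases lt_or_ge 1 b with h | h
      · filter_upwards [self_mem_nhdsWithin] with y hy
        exact (hfm y hy).2.trans_lt h
      · have hbm : b ∈ Set.Ioc (0:ℝ) 1 := ⟨(hfm x hx').1.trans hb, h⟩
        have h1 : 0 < F b x := by
          have := hFR x hx' (hfm x hx') hbm hb
          simpa only [hf0 x hx'] using this
        have h2 := ((hFc b hbm).continuousWithinAt (s := {x : ι → ℝ | ∀ v, 0 < x v})
          (x := x)).eventually (lt_mem_nhds h1)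
        filter_upwards [self_mem_nhdsWithin, h2] with y hy h2
        have := ((hFR y hy).lt_iff_lt (hfm y hy) hbm).1
        simp only [hf0 y hy] at this
        exact this h2
  · intro x y hx hy hxy
    have h := hFx (f x) (hfm x hx) x y hxy
    rw [hf0 x hx] at h
    have := ((hFR y hy).le_iff_le (hfm x hx) (hfm y hy)).1
    simp only [hf0 y hy] at this
    exact this h
end
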